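/- Let m, n be natural numbers and let S be a Presburger-definable subset of ℤ^m × ℤ^n (thought of as parameters p ∈ ℤ^m and variables x ∈ ℤ^n). Let D = {p ∈ ℤ^m | the fiber S_p = {x ∈ ℤ^n | (p,x) ∈ S} is nonempty and has a greatest element with respect to the lexicographic order on ℤ^n}. Then D is a Presburger-definable subset of ℤ^m, and the function sending p ∈ D to the lexicographic maximum of S_p is piecewise quasi-affine on D; i.e., D is a finite disjoint union of Presburger-definable pieces on each of which every coordinate of the lexicographic maximum agrees with a quasi-affine function of p. (This is the parametric integer lexicographic-maximum property underlying Proposition 1 of the paper: the source mapping of a static control program is given on a finite disjoint union of affinely-described subdomains by quasi-affine expressions.) -/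

import Mathlib

/-- An affine function `ℤ^n → ℤ`: `x ↦ b + ∑ i, a i * x i` with integer
coefficients `a i` and integer constant `b`. -/
def IsAffine {n : ℕ} (f : (Fin n → ℤ) → ℤ) : Prop :=
  ∃ (a : Fin n → ℤ) (b : ℤ), ∀ x, f x = b + ∑ i, a i * x i

/-- Presburger-definable subsets of `ℤ^n`: the smallest collection containing
`{x | f x ≥ 0}` for affine `f` and `{x | (m : ℤ) ∣ f x}` for affine `f` and
positive integers `m`, closed under (finite) unions, intersections and
complements. -/
inductive Presburger : ∀ {n : ℕ}, Set (Fin n → ℤ) → Prop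
  | affineGe {n : ℕ} (f : (Fin n → ℤ) → ℤ) (hf : IsAffine f) :
      Presburger {x | 0 ≤ f x}
  | dvd {n : ℕ} (m : ℕ) (hm : 0 < m) (f : (Fin n → ℤ) → ℤ) (hf : IsAffine f) :
      Presburger {x | (m : ℤ) ∣ f x}
  | union {n : ℕ} {S T : Set (Fin n → ℤ)} : Presburger S → Presburger T → Presburger (S ∪ T)
  | inter {n : ℕ} {S T : Set (Fin n → ℤ)} : Presburger S → Presburger T → Presburger (S ∩ T)
  | compl {n : ℕ} {S : Set (Fin n → ℤ)} : Presburger S → Presburger Sᶜ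

/-- Quasi-affine functions `ℤ^n → ℤ`: the smallest collection containing the
coordinate projections and constants, closed under pointwise addition,
subtraction, multiplication by an integer constant, and floor division by a
positive integer. -/
inductive QuasiAffine : ∀ {n : ℕ}, ((Fin n → ℤ) → ℤ) → Prop
  | proj {n : ℕ} (i : Fin n) : QuasiAffine (fun x => x i)
  | const {n : ℕ} (c : ℤ) : QuasiAffine (fun _ : Fin n → ℤ => c)
  | add {n : ℕ} {g h : (Fin n → ℤ) → ℤ} :
      QuasiAffine g → QuasiAffine h → QuasiAffine (fun x => g x + h x)
  | sub {n : ℕ} {g h : (Fin n → ℤ) → ℤ} :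
      QuasiAffine g → QuasiAffine h → QuasiAffine (fun x => g x - h x)
  | smul {n : ℕ} (c : ℤ) {g : (Fin n → ℤ) → ℤ} :
      QuasiAffine g → QuasiAffine (fun x => c * g x)
  | fdiv {n : ℕ} (m : ℕ) (hm : 0 < m) {g : (Fin n → ℤ) → ℤ} :
      QuasiAffine g → QuasiAffine (fun x => Int.fdiv (g x) (m : ℤ))

/-- A scalar-valued function is piecewise quasi-affine on `D`: `D` is a finite
disjoint union of Presburger-definable pieces on each of which the function
agrees with a quasi-affine function. -/
def PiecewiseQuasiAffine {n : ℕ} (D : Set (Fin n → ℤ)) (g : (Fin n → ℤ) → ℤ) : Prop :=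
  ∃ (N : ℕ) (P : Fin N → Set (Fin n → ℤ)) (q : Fin N → (Fin n → ℤ) → ℤ),
    (∀ i, Presburger (P i)) ∧
    (Pairwise fun i j => Disjoint (P i) (P j)) ∧
    (⋃ i, P i) = D ∧
    (∀ i, QuasiAffine (q i)) ∧
    (∀ i, ∀ x ∈ P i, g x = q i x)

/-- A `ℤ^k`-valued function is piecewise quasi-affine on `D`: `D` is a finite
disjoint union of Presburger-definable pieces on each of which every coordinate
of the function agrees with a quasi-affine function. -/
def PiecewiseQuasiAffineVec {n k : ℕ} (D : Set (Fin n → ℤ))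
    (g : (Fin n → ℤ) → (Fin k → ℤ)) : Prop :=
  ∃ (N : ℕ) (P : Fin N → Set (Fin n → ℤ)) (q : Fin N → Fin k → (Fin n → ℤ) → ℤ),
    (∀ i, Presburger (P i)) ∧
    (Pairwise fun i j => Disjoint (P i) (P j)) ∧
    (⋃ i, P i) = D ∧
    (∀ i j, QuasiAffine (q i j)) ∧
    (∀ i, ∀ x ∈ P i, ∀ j, g x j = q i j x)

namespace QuasiAffine

variable {k n : ℕ}

theorem sum {ι : Type*} (s : Finset ι) {g : ι → (Fin n → ℤ) → ℤ}
    (hg : ∀ i, QuasiAffine (g i)) : QuasiAffine fun x => ∑ i ∈ s, g i x := by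
  classical
  induction s using Finset.induction_on with
  | empty => simpa using const 0
  | insert a s ha ih => simpa [Finset.sum_insert ha] using (hg a).add ih

/-- Quasi-affine functions are closed under composition. -/
theorem comp {q : (Fin k → ℤ) → ℤ} (hq : QuasiAffine q) {v : Fin k → (Fin n → ℤ) → ℤ}
    (hv : ∀ i, QuasiAffine (v i)) : QuasiAffine fun p => q fun i => v i p := by
  induction hq with
  | proj i => exact hv i
  | const c => exact const c
  | add _ _ ih₁ ih₂ => exact ih₁.add ih₂
  | sub _ _ ih₁ ih₂ => exact ih₁.sub ih₂
  | smul c _ ih => exact ih.smul c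
  | fdiv m hm _ ih => exact ih.fdiv m hm

end QuasiAffine

theorem IsAffine.quasiAffine {n : ℕ} {f : (Fin n → ℤ) → ℤ} (hf : IsAffine f) :
    QuasiAffine f := by
  obtain ⟨a, b, h⟩ := hf
  obtain rfl := funext h
  exact (QuasiAffine.const b).add (.sum _ fun i => (QuasiAffine.proj i).smul (a i))

namespace IsAffine

variable {n : ℕ} {f g : (Fin n → ℤ) → ℤ}

theorem const (c : ℤ) : IsAffine fun _ : Fin n → ℤ => c := ⟨0, c, by simp⟩

theorem proj (i : Fin n) : IsAffine fun x => x i := ⟨Pi.single i 1, 0, by simp [Pi.single_apply]⟩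

theorem add (hf : IsAffine f) (hg : IsAffine g) : IsAffine fun x => f x + g x := by
  obtain ⟨a, b, h⟩ := hf
  obtain ⟨c, d, h'⟩ := hg
  refine ⟨a + c, b + d, fun x => ?_⟩
  simp only [h, h', Pi.add_apply, add_mul, Finset.sum_add_distrib]
  ring

theorem smul (c : ℤ) (hf : IsAffine f) : IsAffine fun x => c * f x := by
  obtain ⟨a, b, h⟩ := hf
  exact ⟨fun i => c * a i, c * b, fun x => by simp only [h, mul_add, Finset.mul_sum, mul_assoc]⟩

theorem sub (hf : IsAffine f) (hg : IsAffine g) : IsAffine fun x => f x - g x := by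
  simpa [sub_eq_add_neg] using hf.add (hg.smul (-1))

end IsAffine

namespace Presburger

variable {n : ℕ}

theorem empty : Presburger (∅ : Set (Fin n → ℤ)) := by
  simpa using affineGe _ (IsAffine.const (n := n) (-1))

theorem univ : Presburger (Set.univ : Set (Fin n → ℤ)) := by
  simpa using (empty (n := n)).compl

theorem biUnion {ι : Type*} {s : Set ι} (hs : s.Finite) {S : ι → Set (Fin n → ℤ)}
    (hS : ∀ i ∈ s, Presburger (S i)) : Presburger (⋃ i ∈ s, S i) := by
  induction s, hs using Set.Finite.induction_on with
  | empty => simpa using empty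
  | insert _ _ ih =>
    rw [Set.biUnion_insert]
    exact (hS _ (Set.mem_insert _ _)).union (ih fun i hi => hS i (Set.mem_insert_of_mem _ hi))

theorem iUnion {ι : Type*} [Finite ι] {S : ι → Set (Fin n → ℤ)} (hS : ∀ i, Presburger (S i)) :
    Presburger (⋃ i, S i) := by
  simpa using biUnion Set.finite_univ fun i _ => hS i

theorem iInter {ι : Type*} [Finite ι] {S : ι → Set (Fin n → ℤ)} (hS : ∀ i, Presburger (S i)) :
    Presburger (⋂ i, S i) := by
  simpa [Set.compl_iUnion] using (iUnion fun i => (hS i).compl).compl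

end Presburger

/-- A quasi-affine function is, on each piece of a finite Presburger-definable cover, an affine
function divided by a positive integer. -/
theorem QuasiAffine.exists_affine_cover {n : ℕ} {q : (Fin n → ℤ) → ℤ} (hq : QuasiAffine q) :
    ∃ (ι : Type) (_ : Finite ι) (P : ι → Set (Fin n → ℤ)) (K : ι → ℤ)
      (f : ι → (Fin n → ℤ) → ℤ), (∀ i, Presburger (P i)) ∧ (∀ i, 0 < K i) ∧
      (∀ i, IsAffine (f i)) ∧ (∀ i, ∀ x ∈ P i, K i * q x = f i x) ∧ ∀ x, ∃ i, x ∈ P i := by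
  induction hq with
  | proj i =>
    exact ⟨Unit, inferInstance, fun _ => Set.univ, fun _ => 1, fun _ x => x i,
      fun _ => .univ, fun _ => one_pos, fun _ => .proj i, by simp, by simp⟩
  | const c =>
    exact ⟨Unit, inferInstance, fun _ => Set.univ, fun _ => 1, fun _ _ => c,
      fun _ => .univ, fun _ => one_pos, fun _ => .const c, by simp, by simp⟩
  | add _ _ ih₁ ih₂ =>
    obtain ⟨ι, _, P, K, f, hP, hK, hf, h, hc⟩ := ih₁
    obtain ⟨κ, _, P', K', f', hP', hK', hf', h', hc'⟩ := ih₂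
    refine ⟨ι × κ, inferInstance, fun i => P i.1 ∩ P' i.2, fun i => K i.1 * K' i.2,
      fun i x => K' i.2 * f i.1 x + K i.1 * f' i.2 x, fun i => (hP _).inter (hP' _),
      fun i => mul_pos (hK _) (hK' _), fun i => ((hf _).smul _).add ((hf' _).smul _),
      fun i x hx => ?_, fun x => ?_⟩
    · dsimp only
      rw [← h _ x hx.1, ← h' _ x hx.2]; ring
    · obtain ⟨i, hi⟩ := hc x
      obtain ⟨j, hj⟩ := hc' x
      exact ⟨(i, j), hi, hj⟩
  | sub _ _ ih₁ ih₂ =>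
    obtain ⟨ι, _, P, K, f, hP, hK, hf, h, hc⟩ := ih₁
    obtain ⟨κ, _, P', K', f', hP', hK', hf', h', hc'⟩ := ih₂
    refine ⟨ι × κ, inferInstance, fun i => P i.1 ∩ P' i.2, fun i => K i.1 * K' i.2,
      fun i x => K' i.2 * f i.1 x - K i.1 * f' i.2 x, fun i => (hP _).inter (hP' _),
      fun i => mul_pos (hK _) (hK' _), fun i => ((hf _).smul _).sub ((hf' _).smul _),
      fun i x hx => ?_, fun x => ?_⟩
    · dsimp only
      rw [← h _ x hx.1, ← h' _ x hx.2]; ring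
    · obtain ⟨i, hi⟩ := hc x
      obtain ⟨j, hj⟩ := hc' x
      exact ⟨(i, j), hi, hj⟩
  | smul c _ ih =>
    obtain ⟨ι, _, P, K, f, hP, hK, hf, h, hc⟩ := ih
    refine ⟨ι, inferInstance, P, K, fun i x => c * f i x, hP, hK, fun i => (hf i).smul c,
      fun i x hx => ?_, hc⟩
    dsimp only
    rw [← h i x hx]; ring
  | @fdiv m hm g _ ih =>
    obtain ⟨ι, _, P, K, f, hP, hK, hf, h, hc⟩ := ih
    have hm' : (0 : ℤ) < m := by exact_mod_cast hm
    have hKm : ∀ i, 0 < K i * m := fun i => mul_pos (hK i) hm'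
    refine ⟨Σ i, Fin (K i * m).toNat, inferInstance,
      fun i => P i.1 ∩ {x | (((K i.1 * m).toNat : ℕ) : ℤ) ∣ f i.1 x - (i.2 : ℕ)},
      fun i => K i.1 * m, fun i x => f i.1 x - (i.2 : ℕ),
      fun i => (hP _).inter (.dvd _ (by have := hKm i.1; omega) _ ((hf _).sub (.const _))),
      fun i => hKm _, fun i => (hf _).sub (.const _), fun i x hx => ?_, fun x => ?_⟩
    · obtain ⟨i, r, hr⟩ := i
      obtain ⟨hx, c, hd⟩ := hx
      have hpos := hKm i
      rw [Int.toNat_of_nonneg hpos.le] at hd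
      have hr' : (r : ℤ) < K i * m := by omega
      have hfx := h i x hx
      dsimp only at hd ⊢
      rw [Int.fdiv_eq_ediv_of_nonneg _ hm'.le, ← Int.mul_ediv_mul_of_pos _ _ (hK i), hfx,
        show f i x = r + K i * m * c by linarith, Int.add_mul_ediv_left _ _ hpos.ne',
        Int.ediv_eq_zero_of_lt (by omega) hr', zero_add]
      ring
    · obtain ⟨i, hi⟩ := hc x
      have hpos := hKm i
      have h₁ := Int.emod_nonneg (f i x) hpos.ne'
      have h₂ := Int.emod_lt_of_pos (f i x) hpos
      refine ⟨⟨i, (f i x % (K i * m)).toNat, by omega⟩, hi, ?_⟩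
      simp only [Set.mem_ofPred_eq, Int.toNat_of_nonneg hpos.le, Int.toNat_of_nonneg h₁]
      exact Int.dvd_self_sub_emod

namespace Presburger

variable {k m n : ℕ}

theorem setOf_nonneg {q : (Fin n → ℤ) → ℤ} (hq : QuasiAffine q) : Presburger {x | 0 ≤ q x} := by
  obtain ⟨ι, _, P, K, f, hP, hK, hf, h, hc⟩ := hq.exists_affine_cover
  convert iUnion fun i => (hP i).inter (affineGe _ (hf i)) using 1
  ext x
  simp only [Set.mem_ofPred_eq, Set.mem_iUnion, Set.mem_inter_iff]
  constructor
  · intro hx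
    obtain ⟨i, hi⟩ := hc x
    exact ⟨i, hi, h i x hi ▸ mul_nonneg (hK i).le hx⟩
  · rintro ⟨i, hi, hx⟩
    rw [← h i x hi] at hx
    exact nonneg_of_mul_nonneg_right hx (hK i)

theorem setOf_lt {q r : (Fin n → ℤ) → ℤ} (hq : QuasiAffine q) (hr : QuasiAffine r) :
    Presburger {x | q x < r x} := by
  convert setOf_nonneg ((hr.sub hq).sub (.const 1)) using 3
  omega

theorem setOf_eq {q r : (Fin n → ℤ) → ℤ} (hq : QuasiAffine q) (hr : QuasiAffine r) :
    Presburger {x | q x = r x} := by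
  convert (setOf_nonneg (hr.sub hq)).inter (setOf_nonneg (hq.sub hr)) using 1
  ext x
  simp only [Set.mem_ofPred_eq, Set.mem_inter_iff]
  omega

theorem setOf_toLex_lt {u v : Fin k → (Fin n → ℤ) → ℤ} (hu : ∀ i, QuasiAffine (u i))
    (hv : ∀ i, QuasiAffine (v i)) :
    Presburger {x | toLex (fun i => u i x) < toLex (fun i => v i x)} := by
  have H := iUnion fun i : Fin k =>
    (iInter fun j : {j // j < i} => setOf_eq (hu j) (hv j)).inter (setOf_lt (hu i) (hv i))
  convert H using 1
  ext x
  simp only [Set.mem_ofPred_eq, Set.mem_iUnion, Set.mem_inter_iff, Set.mem_iInter, Subtype.forall]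
  exact Iff.rfl

/-- Presburger-definable sets are closed under quasi-affine substitution. -/
theorem preimage {S : Set (Fin k → ℤ)} (hS : Presburger S) {v : Fin k → (Fin n → ℤ) → ℤ}
    (hv : ∀ i, QuasiAffine (v i)) : Presburger {p | (fun i => v i p) ∈ S} := by
  induction hS with
  | affineGe f hf => exact setOf_nonneg (hf.quasiAffine.comp hv)
  | dvd d hd f hf =>
    have hq := hf.quasiAffine.comp hv
    convert setOf_eq ((hq.fdiv d hd).smul d) hq using 3
    rw [Int.fdiv_eq_ediv_of_nonneg _ (by positivity)]
    exact ⟨Int.mul_ediv_cancel', fun h => ⟨_, h.symm⟩⟩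
  | union _ _ ih₁ ih₂ => exact ih₁.union ih₂
  | inter _ _ ih₁ ih₂ => exact ih₁.inter ih₂
  | compl _ ih => exact ih.compl

/-- Along each line `t ↦ u p + t • a`, translation by multiples of `d` preserves membership in `S`
unless it jumps over some `h p` with `h ∈ H`. -/
def IsPeriodicOnLines (S : Set (Fin k → ℤ)) (u : Fin k → (Fin m → ℤ) → ℤ) (a : Fin k → ℤ) (d : ℤ)
    (H : Set ((Fin m → ℤ) → ℤ)) : Prop :=
  ∀ p s t, s ≤ t → d ∣ t - s → (∀ h ∈ H, s < h p → t < h p) →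
    ((fun i => u i p + a i * s) ∈ S ↔ (fun i => u i p + a i * t) ∈ S)

theorem IsPeriodicOnLines.mono {S : Set (Fin k → ℤ)} {u : Fin k → (Fin m → ℤ) → ℤ}
    {a : Fin k → ℤ} {d d' : ℤ} {H H' : Set ((Fin m → ℤ) → ℤ)}
    (h : IsPeriodicOnLines S u a d H) (hd : d ∣ d') (hH : H ⊆ H') :
    IsPeriodicOnLines S u a d' H' :=
  fun p s t hst hdvd hb => h p s t hst (hd.trans hdvd) fun g hg => hb g (hH hg)

/-- Along lines in a fixed direction, membership in a Presburger-definable set is periodic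
away from finitely many points depending quasi-affinely on the base point. -/
theorem exists_isPeriodicOnLines {S : Set (Fin k → ℤ)} (hS : Presburger S)
    {u : Fin k → (Fin m → ℤ) → ℤ} (hu : ∀ i, QuasiAffine (u i)) (a : Fin k → ℤ) :
    ∃ (d : ℤ) (H : Set ((Fin m → ℤ) → ℤ)), 0 < d ∧ H.Finite ∧ (∀ h ∈ H, QuasiAffine h) ∧
      IsPeriodicOnLines S u a d H := by
  have eval_line {f : (Fin k → ℤ) → ℤ} (hf : IsAffine f) : ∃ A : ℤ, ∀ p s,
      f (fun i => u i p + a i * s) = f (fun i => u i p) + A * s := by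
    obtain ⟨c, b, h⟩ := hf
    refine ⟨∑ i, c i * a i, fun p s => ?_⟩
    simp only [h, mul_add, Finset.sum_add_distrib, Finset.sum_mul, add_assoc, mul_assoc]
  induction hS with
  | affineGe f hf =>
    obtain ⟨A, hA⟩ := eval_line hf
    have hq := hf.quasiAffine.comp hu
    simp only [IsPeriodicOnLines, Set.mem_ofPred_eq, hA]
    rcases lt_trichotomy A 0 with hneg | rfl | hpos
    · obtain ⟨B, rfl⟩ : ∃ B : ℕ, A = -B := ⟨A.natAbs, by omega⟩
      have hB : (0 : ℤ) < B := by omega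
      refine ⟨1, {fun p => Int.fdiv (f fun i => u i p) B + 1}, one_pos, Set.finite_singleton _,
        ?_, fun p s t hst _ hb => ?_⟩
      · rintro _ rfl
        exact (hq.fdiv B (by omega)).add (.const 1)
      · have hb := hb _ rfl
        simp only [Int.fdiv_eq_ediv_of_nonneg _ hB.le] at hb
        have e (x : ℤ) : 0 ≤ f (fun i => u i p) + -(B : ℤ) * x ↔ x ≤ f (fun i => u i p) / B := by
          rw [Int.le_ediv_iff_mul_le hB]
          constructor <;> intro <;> linarith
        rw [e, e]
        omega
    · exact ⟨1, ∅, one_pos, Set.finite_empty, by simp, by simp⟩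
    · obtain ⟨B, rfl⟩ : ∃ B : ℕ, A = B := ⟨A.natAbs, by omega⟩
      refine ⟨1, {fun p => 0 - Int.fdiv (f fun i => u i p) B}, one_pos, Set.finite_singleton _,
        ?_, fun p s t hst _ hb => ?_⟩
      · rintro _ rfl
        exact (QuasiAffine.const 0).sub (hq.fdiv B (by omega))
      · have hb := hb _ rfl
        simp only [Int.fdiv_eq_ediv_of_nonneg _ hpos.le] at hb
        have e (x : ℤ) : 0 ≤ f (fun i => u i p) + B * x ↔ -x ≤ f (fun i => u i p) / B := by
          rw [Int.le_ediv_iff_mul_le hpos]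
          constructor <;> intro <;> linarith
        rw [e, e]
        omega
  | dvd d hd f hf =>
    obtain ⟨A, hA⟩ := eval_line hf
    refine ⟨d, ∅, by exact_mod_cast hd, Set.finite_empty, by simp, fun p s t _ hdvd _ => ?_⟩
    simp only [Set.mem_ofPred_eq, hA]
    rw [show f (fun i => u i p) + A * t = f (fun i => u i p) + A * s + A * (t - s) by ring]
    exact (dvd_add_left (hdvd.mul_left A)).symm
  | union _ _ ih₁ ih₂ =>
    obtain ⟨d, H, hd, hH, hq, h⟩ := ih₁
    obtain ⟨d', H', hd', hH', hq', h'⟩ := ih₂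
    refine ⟨d * d', H ∪ H', mul_pos hd hd', hH.union hH', fun g hg => hg.elim (hq g) (hq' g),
      fun p s t hst hdvd hb => or_congr ?_ ?_⟩
    · exact h.mono (dvd_mul_right _ _) Set.subset_union_left p s t hst hdvd hb
    · exact h'.mono (dvd_mul_left _ _) Set.subset_union_right p s t hst hdvd hb
  | inter _ _ ih₁ ih₂ =>
    obtain ⟨d, H, hd, hH, hq, h⟩ := ih₁
    obtain ⟨d', H', hd', hH', hq', h'⟩ := ih₂
    refine ⟨d * d', H ∪ H', mul_pos hd hd', hH.union hH', fun g hg => hg.elim (hq g) (hq' g),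
      fun p s t hst hdvd hb => and_congr ?_ ?_⟩
    · exact h.mono (dvd_mul_right _ _) Set.subset_union_left p s t hst hdvd hb
    · exact h'.mono (dvd_mul_left _ _) Set.subset_union_right p s t hst hdvd hb
  | compl _ ih =>
    obtain ⟨d, H, hd, hH, hq, h⟩ := ih
    exact ⟨d, H, hd, hH, hq, fun p s t hst hdvd hb => not_congr (h p s t hst hdvd hb)⟩

/-- If a line in direction `a` meets a Presburger-definable set, it does so at one of finitely many
points depending quasi-affinely on the base point. -/
theorem exists_witnesses_on_line {S : Set (Fin k → ℤ)} (hS : Presburger S)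
    {u : Fin k → (Fin m → ℤ) → ℤ} (hu : ∀ i, QuasiAffine (u i)) (a : Fin k → ℤ) :
    ∃ H : Set ((Fin m → ℤ) → ℤ), H.Finite ∧ (∀ h ∈ H, QuasiAffine h) ∧
      ∀ p, (∃ t, (fun i => u i p + a i * t) ∈ S) →
        ∃ h ∈ H, (fun i => u i p + a i * h p) ∈ S := by
  obtain ⟨d, H, hd, hH, hq, h⟩ := hS.exists_isPeriodicOnLines hu a
  refine ⟨Set.image2 (fun g c p => g p + c) (insert (fun _ => 0) H) (Set.Ico (-d) d),
    (hH.insert _).image2 _ (Set.finite_Ico _ _), ?_, fun p ⟨t, ht⟩ => ?_⟩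
  · rintro _ ⟨g, hg, c, -, rfl⟩
    rcases hg with rfl | hg
    exacts [(QuasiAffine.const 0).add (.const c), (hq g hg).add (.const c)]
  have emod_le_self {x : ℤ} (hx : 0 ≤ x) : x % d ≤ x := by
    have := mul_nonneg hd.le (Int.ediv_nonneg hx hd.le)
    have := Int.emod_add_mul_ediv x d
    linarith
  suffices ∃ g ∈ insert (fun _ => 0) H, ∃ s, -d ≤ s - g p ∧ s - g p < d ∧
      (fun i => u i p + a i * s) ∈ S by
    obtain ⟨g, hg, s, h₁, h₂, hs⟩ := this
    exact ⟨_, ⟨g, hg, s - g p, ⟨h₁, h₂⟩, rfl⟩, by simpa using hs⟩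
  by_cases hup : ∃ g ∈ insert (fun _ => 0) H, t < g p
  · obtain ⟨g, ⟨hgH, hg⟩, hmin⟩ := Set.exists_min_image {g ∈ insert (fun _ => 0) H | t < g p}
      (fun g => g p) ((hH.insert _).subset fun _ h => h.1) hup
    have h₀ := Int.emod_nonneg (g p - 1 - t) hd.ne'
    have h₁ := Int.emod_lt_of_pos (g p - 1 - t) hd
    have h₂ := emod_le_self (show 0 ≤ g p - 1 - t by omega)
    refine ⟨g, hgH, g p - 1 - (g p - 1 - t) % d, by omega, by omega,
      (h p t _ (by omega) ?_ fun f hf hlt => ?_).1 ht⟩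
    · rw [sub_right_comm]
      exact Int.dvd_self_sub_emod
    · have := hmin f ⟨.inr hf, hlt⟩
      omega
  · push Not at hup
    obtain ⟨g, hgH, hmax⟩ := Set.exists_max_image (insert (fun _ => 0) H) (fun g => g p)
      (hH.insert _) (Set.insert_nonempty _ _)
    have hg := hup g hgH
    have h₀ := Int.emod_nonneg (t - g p) hd.ne'
    have h₁ := Int.emod_lt_of_pos (t - g p) hd
    have h₂ := emod_le_self (show 0 ≤ t - g p by omega)
    refine ⟨g, hgH, g p + (t - g p) % d, by omega, by omega,
      (h p _ t (by omega) ?_ fun f hf hlt => ?_).2 ht⟩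
    · rw [← sub_sub]
      exact Int.dvd_self_sub_emod
    · have := hmax f (.inr hf)
      omega

/-- A Presburger-definable relation has finitely many quasi-affine functions among which every
nonempty fiber finds an element. -/
theorem exists_witnesses {S : Set (Fin (m + n) → ℤ)} (hS : Presburger S) :
    ∃ C : Set ((Fin m → ℤ) → Fin n → ℤ), C.Finite ∧ (∀ c ∈ C, ∀ j, QuasiAffine fun p => c p j) ∧
      ∀ p, (∃ x, Fin.append p x ∈ S) → ∃ c ∈ C, Fin.append p (c p) ∈ S := by
  induction n with
  | zero =>
    refine ⟨{fun _ => Fin.elim0}, Set.finite_singleton _, fun _ _ j => j.elim0, ?_⟩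
    rintro p ⟨x, hx⟩
    exact ⟨_, rfl, by rwa [Subsingleton.elim x Fin.elim0] at hx⟩
  | succ n ih =>
    let u (t : (Fin (m + n) → ℤ) → ℤ) (i : Fin (m + (n + 1))) (w : Fin (m + n) → ℤ) : ℤ :=
      Fin.append (fun j => w (Fin.castAdd n j))
        (Fin.snoc (α := fun _ => ℤ) (fun j => w (Fin.natAdd m j)) (t w)) i
    have hu (t) (ht : QuasiAffine t) (i) : QuasiAffine (u t i) := by
      induction i using Fin.addCases with
      | left i => simpa [u] using QuasiAffine.proj _
      | right i =>
        induction i using Fin.lastCases with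
        | last => simpa only [u, Fin.append_right, Fin.snoc_last] using ht
        | cast i => simpa [u] using QuasiAffine.proj _
    let a : Fin (m + (n + 1)) → ℤ := Fin.append 0 (Fin.snoc (α := fun _ => ℤ) 0 1)
    have hua (p : Fin m → ℤ) (x : Fin n → ℤ) (t : ℤ) :
        (fun i => u (fun _ => 0) i (Fin.append p x) + a i * t) =
          Fin.append p (Fin.snoc (α := fun _ => ℤ) x t) := by
      funext i
      induction i using Fin.addCases with
      | left i => simp [u, a]
      | right i =>
        simp only [u, a, Fin.append_right]
        induction i using Fin.lastCases <;> simp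
    obtain ⟨H, hH, hq, h⟩ := hS.exists_witnesses_on_line (hu _ (.const 0)) a
    obtain ⟨C, hC, hCq, hCS⟩ := ih (biUnion hH fun t ht => hS.preimage (hu t (hq t ht)))
    have hut (t) (p : Fin m → ℤ) (x : Fin n → ℤ) : (fun i => u t i (Fin.append p x)) =
        Fin.append p (Fin.snoc (α := fun _ => ℤ) x (t (Fin.append p x))) := by
      funext i
      simp [u]
    refine ⟨Set.image2 (fun c t p => Fin.snoc (α := fun _ => ℤ) (c p) (t (Fin.append p (c p)))) C H,
      hC.image2 _ hH, ?_, ?_⟩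
    · rintro _ ⟨c, hc, t, ht, rfl⟩ j
      induction j using Fin.lastCases with
      | last =>
        simp only [Fin.snoc_last]
        refine (hq t ht).comp (v := fun i p => Fin.append p (c p) i) fun i => ?_
        induction i using Fin.addCases with
        | left i => simpa using QuasiAffine.proj i
        | right i => simpa using hCq c hc i
      | cast j => simpa using hCq c hc j
    · rintro p ⟨x, hx⟩
      obtain ⟨t, ht, hxt⟩ := h (Fin.append p (Fin.init x)) ⟨x (Fin.last n), by
        rw [hua]; simpa [Fin.snoc_init_self] using hx⟩
      rw [hua] at hxt
      obtain ⟨c, hc, hcS⟩ := hCS p ⟨Fin.init x, by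
        simp only [Set.mem_iUnion, Set.mem_ofPred_eq, hut]
        exact ⟨t, ht, hxt⟩⟩
      simp only [Set.mem_iUnion, Set.mem_ofPred_eq, hut] at hcS
      obtain ⟨t, ht, hcS⟩ := hcS
      exact ⟨_, ⟨c, hc, t, ht, rfl⟩, hcS⟩

theorem preimage_append {S : Set (Fin (m + n) → ℤ)} (hS : Presburger S)
    {u : Fin m → (Fin k → ℤ) → ℤ} {v : (Fin k → ℤ) → Fin n → ℤ} (hu : ∀ i, QuasiAffine (u i))
    (hv : ∀ j, QuasiAffine fun p => v p j) :
    Presburger {p | Fin.append (fun i => u i p) (v p) ∈ S} := by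
  refine hS.preimage (v := fun i p => Fin.append (fun i => u i p) (v p) i) fun i => ?_
  induction i using Fin.addCases with
  | left i => simpa using hu i
  | right i => simpa using hv i

/-- Presburger-definable sets are closed under projection. -/
theorem setOf_exists_append {S : Set (Fin (m + n) → ℤ)} (hS : Presburger S) :
    Presburger {p | ∃ x, Fin.append p x ∈ S} := by
  obtain ⟨C, hC, hq, h⟩ := hS.exists_witnesses
  convert biUnion hC fun c hc => hS.preimage_append QuasiAffine.proj (hq c hc) using 1
  ext p
  simp only [Set.mem_iUnion, Set.mem_ofPred_eq]
  exact ⟨fun hp => by simpa using h p hp, fun ⟨c, _, hc⟩ => ⟨c p, hc⟩⟩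

theorem setOf_lexMax {S : Set (Fin (m + n) → ℤ)} (hS : Presburger S) :
    Presburger {w | w ∈ S ∧ ∀ y : Fin n → ℤ, Fin.append (fun i => w (Fin.castAdd n i)) y ∈ S →
      toLex y ≤ toLex fun j => w (Fin.natAdd m j)} := by
  have hT := (hS.preimage_append (k := m + n + n) (v := fun z j => z (Fin.natAdd (m + n) j))
      (fun i => .proj (Fin.castAdd n (Fin.castAdd n i))) fun j => .proj _).inter
    (setOf_toLex_lt (fun j : Fin n => .proj (Fin.castAdd n (Fin.natAdd m j)))
      fun j => .proj (Fin.natAdd (m + n) j))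
  convert hS.inter hT.setOf_exists_append.compl using 1
  ext w
  simp only [Set.mem_inter_iff, Set.mem_ofPred_eq, Set.mem_compl_iff, Fin.append_left,
    Fin.append_right, not_exists, not_and]
  exact and_congr_right fun _ => forall_congr' fun y => imp_congr_right fun _ => not_lt.symm

end Presburger

/-- A function whose graph over `D` is Presburger-definable is piecewise quasi-affine on `D`. -/
theorem Presburger.piecewiseQuasiAffineVec {m n : ℕ} {G : Set (Fin (m + n) → ℤ)}
    (hG : Presburger G) {g : (Fin m → ℤ) → Fin n → ℤ}
    (hg : ∀ p x, Fin.append p x ∈ G → g p = x) :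
    PiecewiseQuasiAffineVec {p | ∃ x, Fin.append p x ∈ G} g := by
  obtain ⟨C, hC, hq, h⟩ := hG.exists_witnesses
  obtain ⟨N, c, rfl⟩ := hC.fin_embedding
  have hc (i j) : QuasiAffine fun p => c i p j := hq _ (Set.mem_range_self i) j
  let A (i : Fin N) : Set (Fin m → ℤ) := {p | Fin.append p (c i p) ∈ G}
  have hA (i) : Presburger (A i) := hG.preimage_append QuasiAffine.proj (hc i)
  let P (i : Fin N) : Set (Fin m → ℤ) := A i ∩ (⋃ j : {j // j < i}, A j)ᶜ
  have hP (i) : Presburger (P i) :=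
    (hA i).inter (Presburger.iUnion fun j : {j // j < i} => hA j).compl
  have hgP (i) : ∀ p ∈ P i, ∀ j, g p j = c i p j := fun p hp => congrFun (hg p _ hp.1)
  refine ⟨N, P, fun i j p => c i p j, hP, fun i j hij => ?_, ?_, hc, hgP⟩
  · refine Set.disjoint_left.2 ?_
    rintro p ⟨hi, hi'⟩ ⟨hj, hj'⟩
    rcases hij.lt_or_gt with hlt | hlt
    · exact hj' (Set.mem_iUnion.2 ⟨⟨i, hlt⟩, hi⟩)
    · exact hi' (Set.mem_iUnion.2 ⟨⟨j, hlt⟩, hj⟩)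
  · ext p
    simp only [Set.mem_iUnion, Set.mem_ofPred_eq]
    constructor
    · rintro ⟨i, hi, -⟩
      exact ⟨_, hi⟩
    · intro hp
      obtain ⟨_, ⟨d, rfl⟩, hdG⟩ := h p hp
      obtain ⟨i, hi, hmin⟩ := wellFounded_lt.has_min {i | p ∈ A i} ⟨d, hdG⟩
      refine ⟨i, hi, ?_⟩
      rw [Set.mem_compl_iff, Set.mem_iUnion]
      rintro ⟨⟨j, hlt⟩, hj⟩
      exact hmin j hj hlt

/-- **Parametric integer lexicographic-maximum property** (underlying
Proposition 1 of the paper).  If `S ⊆ ℤ^m × ℤ^n` is Presburger-definable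
(pairs encoded via `Fin.append`), then the set `D` of parameters `p` whose
fiber `S_p` is nonempty and has a lexicographically greatest element is
Presburger-definable, and the map sending `p ∈ D` to the lexicographic
maximum of `S_p` is piecewise quasi-affine on `D`. -/
theorem parametric_lex_max (m n : ℕ) (S : Set (Fin (m + n) → ℤ))
    (hS : Presburger S)
    (D : Set (Fin m → ℤ))
    (hD : D = {p | ∃ x : Fin n → ℤ, Fin.append p x ∈ S ∧
      ∀ y : Fin n → ℤ, Fin.append p y ∈ S → toLex y ≤ toLex x}) :
    Presburger D ∧
    ∃ g : (Fin m → ℤ) → (Fin n → ℤ),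
      PiecewiseQuasiAffineVec D g ∧
      ∀ p ∈ D, Fin.append p (g p) ∈ S ∧
        ∀ y : Fin n → ℤ, Fin.append p y ∈ S → toLex y ≤ toLex (g p) := by
  let G : Set (Fin (m + n) → ℤ) := {w | w ∈ S ∧ ∀ y : Fin n → ℤ,
    Fin.append (fun i => w (Fin.castAdd n i)) y ∈ S → toLex y ≤ toLex fun j => w (Fin.natAdd m j)}
  have hG : Presburger G := hS.setOf_lexMax
  have mem_G (p : Fin m → ℤ) (x : Fin n → ℤ) : Fin.append p x ∈ G ↔ Fin.append p x ∈ S ∧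
      ∀ y : Fin n → ℤ, Fin.append p y ∈ S → toLex y ≤ toLex x := by
    simp [G]
  have hDG : D = {p | ∃ x, Fin.append p x ∈ G} := by
    simp only [hD, mem_G]
  have hex (p) : ∃ x, p ∈ D → Fin.append p x ∈ G := by
    by_cases hp : p ∈ D
    · have hp' := hp
      rw [hDG] at hp'
      exact hp'.imp fun _ hx _ => hx
    · exact ⟨0, fun h => absurd h hp⟩
  choose g hg using hex
  refine ⟨hDG ▸ hG.setOf_exists_append, g, ?_, fun p hp => (mem_G _ _).1 (hg p hp)⟩
  rw [hDG]
  refine hG.piecewiseQuasiAffineVec fun p x hx => ?_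
  have h₁ := (mem_G _ _).1 hx
  have h₂ := (mem_G _ _).1 (hg p (hDG ▸ ⟨x, hx⟩))
  exact toLex.injective (le_antisymm (h₁.2 _ h₂.1) (h₂.2 _ h₁.1))
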